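/- There exists an absolute constant ε⋆ > 0 with the following property: for every γ > 0, every ε and B₀ with |ε| < ε⋆ and |1 − B₀| < ε⋆, and every unidirectional Stokes wave solution (ψ, η, r) satisfying ψ_y(0, η(0)) ≥ √(2γ)·(1 − ε) > 0 at the crest and η̂ ≤ B₀·√(2/γ), one has η̂ ≤ √(2/γ) · 1/(1 − ε). -/

import Mathlib

noncomputable section

open Real Set

/-- Partial derivative of `ψ` in the horizontal variable. -/
def px (ψ : ℝ → ℝ → ℝ) (x y : ℝ) : ℝ := deriv (fun t => ψ t y) x

/-- Partial derivative of `ψ` in the vertical variable. -/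
def py (ψ : ℝ → ℝ → ℝ) (x y : ℝ) : ℝ := deriv (fun t => ψ x t) y

/-- Second partial derivative in `x`. -/
def pxx (ψ : ℝ → ℝ → ℝ) (x y : ℝ) : ℝ := deriv (fun t => px ψ t y) x

/-- Second partial derivative in `y`. -/
def pyy (ψ : ℝ → ℝ → ℝ) (x y : ℝ) : ℝ := deriv (fun t => py ψ x t) y

/-- Depth `d(s)` of the laminar (stream) flow with surface value `s` of `ψ_y`. -/
def lamDepth (γ s : ℝ) : ℝ := (-s + Real.sqrt (s ^ 2 + 2 * γ)) / γ

/-- Bernoulli constant `R(s) = ½ s² + γ + d(s)` of the laminar flow. -/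
def bernR (γ s : ℝ) : ℝ := s ^ 2 / 2 + γ + lamDepth γ s

/-- `s` is the (unique) positive critical point `s_c` of `R`, characterized by the
equation `s - 1/γ + s/(γ √(s² + 2γ)) = 0`. -/
def IsCrit (γ s : ℝ) : Prop :=
  0 < s ∧ s - 1 / γ + s / (γ * Real.sqrt (s ^ 2 + 2 * γ)) = 0

/-- A solution `(ψ, η, r)` of the stream-function formulation with constant adverse
vorticity `ω = -γ`:  `Δψ = γ` in the fluid domain `D_η`, the Bernoulli condition on the
surface, `ψ = 1` on the surface and `ψ = 0` on the flat bottom. -/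
structure StreamSolution (γ : ℝ) (ψ : ℝ → ℝ → ℝ) (η : ℝ → ℝ) (r : ℝ) : Prop where
  eta_smooth : ContDiff ℝ (⊤ : ℕ∞) η
  eta_pos : ∀ x, 0 < η x
  psi_smooth : ContDiff ℝ (⊤ : ℕ∞) (fun p : ℝ × ℝ => ψ p.1 p.2)
  laplace : ∀ x y, 0 < y → y < η x → pxx ψ x y + pyy ψ x y = γ
  bernoulli : ∀ x, (px ψ x (η x)) ^ 2 / 2 + (py ψ x (η x)) ^ 2 / 2 + η x = r
  surface_val : ∀ x, ψ x (η x) = 1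
  bottom_val : ∀ x, ψ x 0 = 0

/-- The flow is unidirectional: `ψ_y > 0` everywhere in the fluid domain `D_η`. -/
def Unidirectional (ψ : ℝ → ℝ → ℝ) (η : ℝ → ℝ) : Prop :=
  ∀ x y, 0 < y → y < η x → 0 < py ψ x y

/-- A Stokes wave with half-period `Λ`: the solution is `2Λ`-periodic and even in `x`,
and the surface profile is strictly decreasing from the crest (`x = 0`) to the
trough (`x = Λ`).  Thus `η̂ = max η = η 0` and `η̌ = min η = η Λ`. -/
structure StokesWave (γ : ℝ) (ψ : ℝ → ℝ → ℝ) (η : ℝ → ℝ) (r Λ : ℝ) : Prop where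
  sol : StreamSolution γ ψ η r
  lam_pos : 0 < Λ
  eta_periodic : ∀ x, η (x + 2 * Λ) = η x
  eta_even : ∀ x, η (-x) = η x
  psi_periodic : ∀ x y, ψ (x + 2 * Λ) y = ψ x y
  psi_even : ∀ x y, ψ (-x) y = ψ x y
  eta_anti : StrictAntiOn η (Set.Icc 0 Λ)

/-- A solitary wave (relative to the critical value `sc = s_c` of `γ`): the solution is
even in `x`, the profile is strictly decreasing on `(0, ∞)` and non-constant, and the
flow converges to a supercritical laminar flow `(U(·; s), d(s))` with `s > s_c`,
`R(s) = r` as `|x| → ∞`.  The crest is at `x = 0`, `η̂ = η 0` and `η̌ = inf η = d(s)`. -/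
structure SolitaryWave (γ sc : ℝ) (ψ : ℝ → ℝ → ℝ) (η : ℝ → ℝ) (r : ℝ) : Prop where
  sol : StreamSolution γ ψ η r
  eta_even : ∀ x, η (-x) = η x
  psi_even : ∀ x y, ψ (-x) y = ψ x y
  eta_anti : StrictAntiOn η (Set.Ioi 0)
  nonconst : ∃ x₁ x₂, η x₁ ≠ η x₂
  asymptotic : ∃ s, sc < s ∧ bernR γ s = r ∧
    ∀ ε > 0, ∃ X : ℝ, ∀ x : ℝ, X ≤ |x| →
      |η x - lamDepth γ s| ≤ ε ∧
      ∀ y ∈ Set.Icc 0 (η x), |px ψ x y| + |py ψ x y - (γ * y + s)| ≤ ε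

open Filter Topology in
theorem second_deriv_nonneg_of_isLocalMin {F F' : ℝ → ℝ} {c a : ℝ}
    (h1 : ∀ s, HasDerivAt F (F' s) s) (h2 : HasDerivAt F' c a) (hm : IsLocalMin F a) :
    0 ≤ c := by
  by_contra hc
  push Not at hc
  have e : deriv F = F' := funext fun s => (h1 s).deriv
  have hd : deriv F a = 0 := hm.deriv_eq_zero
  have hM : IsLocalMax F a := by
    apply isLocalMax_of_deriv_deriv_neg _ hd (h1 a).continuousAt
    rw [e, h2.deriv]; exact hc
  have hconst : F =ᶠ[𝓝 a] fun _ => F a := by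
    filter_upwards [hm, hM] with s hs1 hs2
    exact le_antisymm hs2 hs1
  have h3 : deriv F =ᶠ[𝓝 a] deriv (fun _ => F a) := hconst.deriv
  have h4 := h3.deriv_eq
  rw [e, h2.deriv] at h4
  simp at h4
  linarith

open Filter Topology in
theorem deriv_nonpos_of_left {F : ℝ → ℝ} {c a : ℝ} (h : HasDerivAt F c a)
    (hm : ∀ᶠ s in 𝓝[<] a, F a ≤ F s) : c ≤ 0 := by
  have h1 := (hasDerivAt_iff_tendsto_slope_left_right.1 h).1
  refine le_of_tendsto h1 ?_
  filter_upwards [hm, self_mem_nhdsWithin] with s hs hs2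
  rw [slope_def_field]
  apply div_nonpos_of_nonneg_of_nonpos
  · linarith
  · have : s < a := hs2
    linarith

open Filter Topology in
theorem deriv_nonneg_of_right {F : ℝ → ℝ} {c a : ℝ} (h : HasDerivAt F c a)
    (hm : ∀ᶠ s in 𝓝[>] a, F a ≤ F s) : 0 ≤ c := by
  have h1 := (hasDerivAt_iff_tendsto_slope_left_right.1 h).2
  refine ge_of_tendsto h1 ?_
  filter_upwards [hm, self_mem_nhdsWithin] with s hs hs2
  rw [slope_def_field]
  apply div_nonneg
  · linarith
  · have : a < s := hs2
    linarith

/-- Joint smoothness of a curried function. -/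
def Sm (f : ℝ → ℝ → ℝ) : Prop := ContDiff ℝ (⊤ : ℕ∞) (fun p : ℝ × ℝ => f p.1 p.2)

theorem Sm.hasFDerivAt {f : ℝ → ℝ → ℝ} (h : Sm f) (p : ℝ × ℝ) :
    HasFDerivAt (fun p : ℝ × ℝ => f p.1 p.2) (fderiv ℝ (fun p : ℝ × ℝ => f p.1 p.2) p) p :=
  (h.differentiable (by simp) p).hasFDerivAt

theorem Sm.px_eq {f : ℝ → ℝ → ℝ} (h : Sm f) (x y : ℝ) :
    px f x y = fderiv ℝ (fun p : ℝ × ℝ => f p.1 p.2) (x, y) (1, 0) := by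
  have h1 : HasDerivAt (fun t : ℝ => (t, y)) ((1 : ℝ), (0 : ℝ)) x :=
    (hasDerivAt_id x).prodMk (hasDerivAt_const x y)
  exact ((h.hasFDerivAt (x, y)).comp_hasDerivAt x h1).deriv

theorem Sm.py_eq {f : ℝ → ℝ → ℝ} (h : Sm f) (x y : ℝ) :
    py f x y = fderiv ℝ (fun p : ℝ × ℝ => f p.1 p.2) (x, y) (0, 1) := by
  have h1 : HasDerivAt (fun t : ℝ => (x, t)) ((0 : ℝ), (1 : ℝ)) y :=
    (hasDerivAt_const y x).prodMk (hasDerivAt_id y)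
  exact ((h.hasFDerivAt (x, y)).comp_hasDerivAt y h1).deriv

theorem Sm.px {f : ℝ → ℝ → ℝ} (h : Sm f) : Sm (px f) := by
  have : (fun p : ℝ × ℝ => _root_.px f p.1 p.2) =
      fun p => fderiv ℝ (fun p : ℝ × ℝ => f p.1 p.2) p (1, 0) := by
    funext p; exact h.px_eq p.1 p.2
  unfold Sm
  rw [this]
  exact (h.fderiv_right (m := (⊤ : ℕ∞)) (by simp)).clm_apply contDiff_const

theorem Sm.py {f : ℝ → ℝ → ℝ} (h : Sm f) : Sm (py f) := by
  have : (fun p : ℝ × ℝ => _root_.py f p.1 p.2) =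
      fun p => fderiv ℝ (fun p : ℝ × ℝ => f p.1 p.2) p (0, 1) := by
    funext p; exact h.py_eq p.1 p.2
  unfold Sm
  rw [this]
  exact (h.fderiv_right (m := (⊤ : ℕ∞)) (by simp)).clm_apply contDiff_const

theorem Sm.chain {f : ℝ → ℝ → ℝ} (h : Sm f) {a b : ℝ → ℝ} {a' b' x : ℝ}
    (ha : HasDerivAt a a' x) (hb : HasDerivAt b b' x) :
    HasDerivAt (fun t => f (a t) (b t))
      (_root_.px f (a x) (b x) * a' + _root_.py f (a x) (b x) * b') x := by
  have h1 := (h.hasFDerivAt (a x, b x)).comp_hasDerivAt x (ha.prodMk hb)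
  have e : fderiv ℝ (fun p : ℝ × ℝ => f p.1 p.2) (a x, b x) (a', b') =
      _root_.px f (a x) (b x) * a' + _root_.py f (a x) (b x) * b' := by
    rw [h.px_eq, h.py_eq]
    have : ((a', b') : ℝ × ℝ) = a' • ((1 : ℝ), (0 : ℝ)) + b' • ((0 : ℝ), (1 : ℝ)) := by
      simp
    rw [this, map_add, map_smul, map_smul]
    simp [mul_comm]
  rw [← e]; exact h1

theorem Sm.hx {f : ℝ → ℝ → ℝ} (h : Sm f) (x y : ℝ) :
    HasDerivAt (fun t => f t y) (_root_.px f x y) x := by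
  simpa using h.chain (hasDerivAt_id x) (hasDerivAt_const x y)

theorem Sm.hy {f : ℝ → ℝ → ℝ} (h : Sm f) (x y : ℝ) :
    HasDerivAt (fun t => f x t) (_root_.py f x y) y := by
  simpa using h.chain (hasDerivAt_const y x) (hasDerivAt_id y)

theorem Sm.cont {f : ℝ → ℝ → ℝ} (h : Sm f) : Continuous (fun p : ℝ × ℝ => f p.1 p.2) :=
  ContDiff.continuous h

theorem Sm.cont2 {f : ℝ → ℝ → ℝ} (h : Sm f) {X : Type*} [TopologicalSpace X] {a b : X → ℝ}
    (ha : Continuous a) (hb : Continuous b) : Continuous (fun t => f (a t) (b t)) :=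
  h.cont.comp (ha.prodMk hb)

theorem Sm.comm {f : ℝ → ℝ → ℝ} (h : Sm f) :
    _root_.py (_root_.px f) = _root_.px (_root_.py f) := by
  funext x y
  rw [h.px.py_eq, h.py.px_eq]
  have ex : (fun p : ℝ × ℝ => _root_.px f p.1 p.2) =
      fun p => fderiv ℝ (fun p : ℝ × ℝ => f p.1 p.2) p (1, 0) := by
    funext p; exact h.px_eq p.1 p.2
  have ey : (fun p : ℝ × ℝ => _root_.py f p.1 p.2) =
      fun p => fderiv ℝ (fun p : ℝ × ℝ => f p.1 p.2) p (0, 1) := by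
    funext p; exact h.py_eq p.1 p.2
  have hd : DifferentiableAt ℝ (fderiv ℝ (fun p : ℝ × ℝ => f p.1 p.2)) (x, y) :=
    ((h.fderiv_right (m := (⊤ : ℕ∞)) (by simp)).differentiable (by simp)) _
  have key : ∀ v w : ℝ × ℝ,
      fderiv ℝ (fun p => fderiv ℝ (fun p : ℝ × ℝ => f p.1 p.2) p v) (x, y) w =
      fderiv ℝ (fderiv ℝ (fun p : ℝ × ℝ => f p.1 p.2)) (x, y) w v := by
    intro v w
    have := (hd.hasFDerivAt.clm_apply (hasFDerivAt_const v (x, y))).fderiv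
    rw [this]
    simp
  rw [ex, ey, key, key]
  have hs : IsSymmSndFDerivAt ℝ (fun p : ℝ × ℝ => f p.1 p.2) (x, y) :=
    ((contDiff_infty.1 h 2).contDiffAt).isSymmSndFDerivAt (by simp)
  exact hs _ _

open Filter Topology in
/-- Weak minimum principle below a graph. -/
theorem nonneg_of_harmonic {f : ℝ → ℝ → ℝ} (hf : Sm f) {η : ℝ → ℝ} (hη : Continuous η)
    {Λ M : ℝ} (hM : ∀ x, η x ≤ M)
    (h0 : ∀ y, 0 ≤ f 0 y) (hL : ∀ y, 0 ≤ f Λ y) (hb : ∀ x, 0 ≤ f x 0)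
    (hs : ∀ x, 0 < x → x < Λ → 0 ≤ f x (η x))
    (hl : ∀ x y, 0 < x → x < Λ → 0 < y → y < η x → px (px f) x y + py (py f) x y = 0)
    {x y : ℝ} (hx0 : 0 ≤ x) (hxL : x ≤ Λ) (hy0 : 0 ≤ y) (hyη : y ≤ η x) : 0 ≤ f x y := by
  have main : ∀ κ > 0, 0 ≤ f x y + κ * (M ^ 2 - y ^ 2) := by
    intro κ hκ
    set K : Set (ℝ × ℝ) := (Set.Icc 0 Λ ×ˢ Set.Icc 0 M) ∩ {p | p.2 ≤ η p.1} with hK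
    have hKc : IsCompact K :=
      (isCompact_Icc.prod isCompact_Icc).inter_right
        (isClosed_le continuous_snd (hη.comp continuous_fst))
    have hxy : (x, y) ∈ K := ⟨⟨⟨hx0, hxL⟩, ⟨hy0, hyη.trans (hM x)⟩⟩, hyη⟩
    have hgc : Continuous (fun p : ℝ × ℝ => f p.1 p.2 + κ * (M ^ 2 - p.2 ^ 2)) := by
      have := hf.cont
      fun_prop
    obtain ⟨⟨a, b⟩, hab, hmin⟩ := hKc.exists_isMinOn ⟨_, hxy⟩ hgc.continuousOn
    have hle : f a b + κ * (M ^ 2 - b ^ 2) ≤ f x y + κ * (M ^ 2 - y ^ 2) := hmin hxy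
    refine le_trans ?_ hle
    obtain ⟨⟨⟨ha0, haL⟩, ⟨hb0, hbM⟩⟩, hbη⟩ := hab
    change b ≤ η a at hbη
    dsimp only at ha0 haL hb0 hbM
    have hMb : 0 ≤ κ * (M ^ 2 - b ^ 2) := by
      apply mul_nonneg hκ.le
      nlinarith
    rcases ha0.eq_or_lt with rfl | ha0
    · linarith [h0 b]
    rcases haL.eq_or_lt with rfl | haL
    · linarith [hL b]
    rcases hb0.eq_or_lt with rfl | hb0
    · linarith [hb a]
    rcases hbη.eq_or_lt with rfl | hbη
    · linarith [hs a ha0 haL]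
    exfalso
    have hxx : 0 ≤ px (px f) a b := by
      refine second_deriv_nonneg_of_isLocalMin (F := fun s => f s b + κ * (M ^ 2 - b ^ 2))
        (F' := fun s => px f s b) (a := a) (fun s => (hf.hx s b).add_const _) (hf.px.hx a b) ?_
      have e1 : ∀ᶠ s in 𝓝 a, b < η s := hη.continuousAt.eventually (lt_mem_nhds hbη)
      filter_upwards [e1, lt_mem_nhds ha0, gt_mem_nhds haL] with s s1 s2 s3
      have : (s, b) ∈ K := ⟨⟨⟨s2.le, s3.le⟩, ⟨hb0.le, hbM⟩⟩, s1.le⟩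
      exact hmin this
    have hyy : 0 ≤ py (py f) a b + κ * (0 - 2) := by
      refine second_deriv_nonneg_of_isLocalMin (F := fun s => f a s + κ * (M ^ 2 - s ^ 2))
        (F' := fun s => py f a s + κ * (0 - 2 * s)) (a := b) (fun s => ?_) ?_ ?_
      · refine (hf.hy a s).add (HasDerivAt.const_mul κ ?_)
        exact ((hasDerivAt_pow 2 s).const_sub (M ^ 2)).congr_deriv (by norm_num)
      · refine (hf.py.hy a b).add (HasDerivAt.const_mul κ ?_)
        exact (((hasDerivAt_id b).const_mul 2).const_sub 0).congr_deriv (by norm_num)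
      filter_upwards [lt_mem_nhds hb0, gt_mem_nhds hbη] with s s2 s3
      have : (a, s) ∈ K := ⟨⟨⟨ha0.le, haL.le⟩, ⟨s2.le, s3.le.trans (hM a)⟩⟩, s3.le⟩
      exact hmin this
    have := hl a b ha0 haL hb0 hbη
    linarith
  by_contra hneg
  push Not at hneg
  have hMy : 0 ≤ M ^ 2 - y ^ 2 := by nlinarith [hM x]
  have h1 := main (-f x y / (2 * (M ^ 2 - y ^ 2 + 1))) (by
    apply div_pos <;> linarith)
  have h2 : -f x y / (2 * (M ^ 2 - y ^ 2 + 1)) * (M ^ 2 - y ^ 2) ≤ -f x y / 2 := by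
    rw [div_mul_eq_mul_div, div_le_div_iff₀ (by linarith) (by norm_num)]
    nlinarith
  linarith

open Filter Topology MeasureTheory in
theorem leibniz {F F' : ℝ → ℝ → ℝ} (hF : Continuous (fun p : ℝ × ℝ => F p.1 p.2))
    (hF' : Continuous (fun p : ℝ × ℝ => F' p.1 p.2))
    (hd : ∀ x s, HasDerivAt (fun x => F x s) (F' x s) x) (x : ℝ) :
    HasDerivAt (fun x => ∫ s in (0 : ℝ)..1, F x s) (∫ s in (0 : ℝ)..1, F' x s) x := by
  have hc : IsCompact (Set.Icc (x - 1) (x + 1) ×ˢ Set.Icc (0 : ℝ) 1) :=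
    isCompact_Icc.prod isCompact_Icc
  obtain ⟨C, hC⟩ := hc.exists_bound_of_continuousOn hF'.continuousOn
  have hFx : ∀ x, Continuous (F x) := fun x => hF.comp (by fun_prop : Continuous fun s => (x, s))
  have hFx' : ∀ x, Continuous (F' x) := fun x => hF'.comp (by fun_prop : Continuous fun s => (x, s))
  refine (intervalIntegral.hasDerivAt_integral_of_dominated_loc_of_deriv_le
    (bound := fun _ => C) (s := Set.Icc (x - 1) (x + 1))
    (Icc_mem_nhds (by linarith) (by linarith)) ?_ ?_ ?_ ?_ ?_ ?_).2
  · exact Eventually.of_forall fun x => (hFx x).aestronglyMeasurable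
  · exact (hFx x).intervalIntegrable _ _
  · exact (hFx' x).aestronglyMeasurable
  · refine Eventually.of_forall fun s hs z hz => ?_
    rw [Set.uIoc_of_le zero_le_one] at hs
    exact hC (z, s) ⟨hz, ⟨hs.1.le, hs.2⟩⟩
  · exact intervalIntegrable_const
  · exact Eventually.of_forall fun s _ z _ => hd z s

theorem StokesWave.px_zero {γ r Λ : ℝ} {ψ : ℝ → ℝ → ℝ} {η : ℝ → ℝ}
    (h : StokesWave γ ψ η r Λ) (y : ℝ) : px ψ 0 y = 0 := by
  have hs : Sm ψ := h.sol.psi_smooth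
  have h1 := hs.hx 0 y
  have h2 : HasDerivAt (fun t => ψ (-t) y) (px ψ (-0) y * (-1) + py ψ (-0) y * 0) 0 :=
    hs.chain (hasDerivAt_neg (0 : ℝ)) (hasDerivAt_const _ _)
  have e : (fun t => ψ (-t) y) = fun t => ψ t y := funext fun t => h.psi_even t y
  rw [e] at h2
  have := h1.unique h2
  rw [neg_zero] at this
  linarith

theorem StokesWave.px_lam {γ r Λ : ℝ} {ψ : ℝ → ℝ → ℝ} {η : ℝ → ℝ}
    (h : StokesWave γ ψ η r Λ) (y : ℝ) : px ψ Λ y = 0 := by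
  have hs : Sm ψ := h.sol.psi_smooth
  have h1 := hs.hx Λ y
  have h2 : HasDerivAt (fun t => ψ (2 * Λ - t) y)
      (px ψ (2 * Λ - Λ) y * (-1) + py ψ (2 * Λ - Λ) y * 0) Λ :=
    hs.chain ((hasDerivAt_id' Λ).const_sub (2 * Λ)) (hasDerivAt_const _ _)
  have e : (fun t => ψ (2 * Λ - t) y) = fun t => ψ t y := funext fun t => by
    rw [← h.psi_even t y, ← h.psi_periodic (-t) y]
    congr 1; ring
  rw [e] at h2
  have := h1.unique h2
  rw [show 2 * Λ - Λ = Λ by ring] at this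
  linarith

theorem StokesWave.exists_rep {γ r Λ : ℝ} {ψ : ℝ → ℝ → ℝ} {η : ℝ → ℝ}
    (h : StokesWave γ ψ η r Λ) (x : ℝ) :
    ∃ z ∈ Set.Icc (-Λ) Λ, η x = η z ∧ ∀ y, ψ x y = ψ z y := by
  have hp : Function.Periodic (fun x => (η x, fun y => ψ x y)) (2 * Λ) := by
    intro x
    simp only [h.eta_periodic, h.psi_periodic]
  obtain ⟨z, hz, e⟩ := hp.exists_mem_Ico (by linarith [h.lam_pos]) x (-Λ)
  refine ⟨z, ⟨hz.1, by linarith [hz.2]⟩, ?_, ?_⟩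
  · exact (Prod.ext_iff.1 e).1
  · intro y; exact congrFun (Prod.ext_iff.1 e).2 y

theorem StokesWave.eta_bounds {γ r Λ : ℝ} {ψ : ℝ → ℝ → ℝ} {η : ℝ → ℝ}
    (h : StokesWave γ ψ η r Λ) (x : ℝ) : η Λ ≤ η x ∧ η x ≤ η 0 := by
  obtain ⟨z, hz, e, -⟩ := h.exists_rep x
  have e2 : η z = η |z| := by
    rcases abs_choice z with hh | hh <;> rw [hh]
    rw [h.eta_even]
  have hz2 : |z| ∈ Set.Icc 0 Λ := ⟨abs_nonneg z, abs_le.2 hz⟩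
  have hL := h.lam_pos
  rw [e, e2]
  exact ⟨h.eta_anti.antitoneOn hz2 ⟨hL.le, le_rfl⟩ hz2.2,
    h.eta_anti.antitoneOn ⟨le_rfl, hL.le⟩ hz2 hz2.1⟩

theorem py_nonneg_closed {ψ : ℝ → ℝ → ℝ} {η : ℝ → ℝ} (hs : Sm ψ) (hη : ∀ x, 0 < η x)
    (hU : Unidirectional ψ η) {x y : ℝ} (h0 : 0 ≤ y) (h1 : y ≤ η x) : 0 ≤ py ψ x y := by
  have hc : Continuous (fun y => py ψ x y) := hs.py.cont2 continuous_const continuous_id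
  have hcl : IsClosed {y | 0 ≤ py ψ x y} := isClosed_le continuous_const hc
  have hsub : Set.Ioo 0 (η x) ⊆ {y | 0 ≤ py ψ x y} := fun y hy => (hU x y hy.1 hy.2).le
  have := closure_minimal hsub hcl
  rw [closure_Ioo (hη x).ne] at this
  exact this ⟨h0, h1⟩

/-- Differentiated kinematic condition. -/
theorem surf_px {γ r : ℝ} {ψ : ℝ → ℝ → ℝ} {η : ℝ → ℝ} (h : StreamSolution γ ψ η r) (x : ℝ) :
    px ψ x (η x) = - (py ψ x (η x) * deriv η x) := by
  have hs : Sm ψ := h.psi_smooth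
  have hη : HasDerivAt η (deriv η x) x := (h.eta_smooth.differentiable (by simp) x).hasDerivAt
  have h1 := hs.chain (hasDerivAt_id' x) hη
  have e : (fun t => ψ t (η t)) = fun _ => 1 := funext h.surface_val
  rw [e] at h1
  have := h1.unique (hasDerivAt_const x 1)
  linarith

theorem bottom_px {γ r : ℝ} {ψ : ℝ → ℝ → ℝ} {η : ℝ → ℝ} (h : StreamSolution γ ψ η r) (x : ℝ) :
    px ψ x 0 = 0 := by
  have e : (fun t => ψ t 0) = fun _ => 0 := funext h.bottom_val
  unfold px
  rw [e]; simp

open Filter Topology in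
theorem px_laplace {γ r : ℝ} {ψ : ℝ → ℝ → ℝ} {η : ℝ → ℝ} (h : StreamSolution γ ψ η r)
    {x y : ℝ} (h0 : 0 < y) (h1 : y < η x) :
    px (px (px ψ)) x y + py (py (px ψ)) x y = 0 := by
  have hs : Sm ψ := h.psi_smooth
  rw [hs.comm, hs.py.comm]
  have hd := (hs.px.px.hx x y).add (hs.py.py.hx x y)
  have e : (fun t => px (px ψ) t y) + (fun t => py (py ψ) t y) =ᶠ[𝓝 x] fun _ => γ := by
    have e1 : ∀ᶠ s in 𝓝 x, y < η s :=
      h.eta_smooth.continuous.continuousAt.eventually (lt_mem_nhds h1)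
    filter_upwards [e1] with s hs
    exact h.laplace s y h0 hs
  exact hd.unique ((hasDerivAt_const x γ).congr_of_eventuallyEq e)

theorem StokesWave.px_nonneg {γ r Λ : ℝ} {ψ : ℝ → ℝ → ℝ} {η : ℝ → ℝ}
    (h : StokesWave γ ψ η r Λ) (hU : Unidirectional ψ η) {x y : ℝ}
    (hx0 : 0 ≤ x) (hxL : x ≤ Λ) (hy0 : 0 ≤ y) (hyη : y ≤ η x) : 0 ≤ px ψ x y := by
  have hs : Sm ψ := h.sol.psi_smooth
  refine nonneg_of_harmonic hs.px h.sol.eta_smooth.continuous (M := η 0) (Λ := Λ)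
    (fun x => (h.eta_bounds x).2) (fun y => (h.px_zero y).ge) (fun y => (h.px_lam y).ge)
    (fun x => (bottom_px h.sol x).ge) ?_ ?_ hx0 hxL hy0 hyη
  · intro x hx0 hxL
    rw [surf_px h.sol]
    have h1 := py_nonneg_closed hs h.sol.eta_pos hU (h.sol.eta_pos x).le le_rfl
    have h2 : deriv η x ≤ 0 := by
      have hd : HasDerivAt η (deriv η x) x :=
        (h.sol.eta_smooth.differentiable (by simp) x).hasDerivAt
      apply deriv_nonpos_of_left hd
      filter_upwards [Ioo_mem_nhdsLT hx0] with s hs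
      exact (h.eta_anti ⟨hs.1.le, hs.2.le.trans hxL.le⟩ ⟨hx0.le, hxL.le⟩ hs.2).le
    nlinarith
  · intro x y _ _ hy0 hyη
    exact px_laplace h.sol hy0 hyη

theorem StokesWave.trough_pyy {γ r Λ : ℝ} {ψ : ℝ → ℝ → ℝ} {η : ℝ → ℝ}
    (h : StokesWave γ ψ η r Λ) (hU : Unidirectional ψ η) {y : ℝ}
    (hy0 : 0 < y) (hyη : y < η Λ) : γ ≤ pyy ψ Λ y := by
  have hs : Sm ψ := h.sol.psi_smooth
  have h1 : pxx ψ Λ y ≤ 0 := by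
    apply deriv_nonpos_of_left (hs.px.hx Λ y)
    filter_upwards [Ioo_mem_nhdsLT h.lam_pos] with s hs
    rw [h.px_lam]
    exact h.px_nonneg hU hs.1.le hs.2.le hy0.le (hyη.le.trans (h.eta_bounds s).1)
  have := h.sol.laplace Λ y hy0 hyη
  linarith

/-- The reflection argument. -/
theorem StokesWave.reflection {γ r Λ : ℝ} {ψ : ℝ → ℝ → ℝ} {η : ℝ → ℝ} (hγ : 0 < γ)
    (h : StokesWave γ ψ η r Λ) (hU : Unidirectional ψ η) (hu : 0 < py ψ 0 (η 0))
    (hhalf : η 0 / 2 ≤ η Λ) : py ψ 0 (η 0) * η 0 ≤ 2 := by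
  have hs : Sm ψ := h.sol.psi_smooth
  set t := η 0 with ht
  have htpos : 0 < t := h.sol.eta_pos 0
  have hηc : Continuous η := h.sol.eta_smooth.continuous
  have hlow : ∀ x, t / 2 ≤ η x := fun x => hhalf.trans (h.eta_bounds x).1
  have hup : ∀ x, η x ≤ t := fun x => (h.eta_bounds x).2
  have hV : ∀ x, 0 < py ψ x (η x) := by
    intro x
    have h1 := py_nonneg_closed hs h.sol.eta_pos hU (h.sol.eta_pos x).le le_rfl
    rcases h1.eq_or_lt with h1 | h1
    · exfalso
      have b0 := h.sol.bernoulli 0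
      have b1 := h.sol.bernoulli x
      rw [h.px_zero] at b0
      rw [surf_px h.sol, ← h1] at b1
      have := hup x
      nlinarith
    · exact h1
  have main : ∀ κ > 0, ∀ y ∈ Set.Icc (t / 2) t,
      0 ≤ ψ 0 (min y (η 0)) - ψ 0 (t - y) - (2 * y / t - 1) + κ * ((y - t / 2) * (t - y)) := by
    intro κ hκ y0 hy0
    set Z : ℝ → ℝ → ℝ := fun x y =>
      ψ x (min y (η x)) - ψ x (t - y) - (2 * y / t - 1) + κ * ((y - t / 2) * (t - y)) with hZ
    have hZc : Continuous (fun p : ℝ × ℝ => Z p.1 p.2) := by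
      have c1 : Continuous (fun p : ℝ × ℝ => ψ p.1 (min p.2 (η p.1))) :=
        hs.cont2 continuous_fst (continuous_snd.min (hηc.comp continuous_fst))
      have c2 : Continuous (fun p : ℝ × ℝ => ψ p.1 (t - p.2)) :=
        hs.cont2 continuous_fst (by fun_prop)
      exact ((c1.sub c2).sub (by fun_prop)).add (by fun_prop)
    have hKc : IsCompact (Set.Icc (-Λ) Λ ×ˢ Set.Icc (t / 2) t) :=
      isCompact_Icc.prod isCompact_Icc
    have hmem : ((0 : ℝ), y0) ∈ Set.Icc (-Λ) Λ ×ˢ Set.Icc (t / 2) t :=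
      ⟨⟨by linarith [h.lam_pos], h.lam_pos.le⟩, hy0⟩
    obtain ⟨⟨a, b⟩, hab, hmin⟩ := hKc.exists_isMinOn ⟨_, hmem⟩ hZc.continuousOn
    refine le_trans ?_ (hmin hmem : Z a b ≤ Z 0 y0)
    have hgl : ∀ x, ∀ y ∈ Set.Icc (t / 2) t, Z a b ≤ Z x y := by
      intro x y hy
      obtain ⟨z, hz, e1, e2⟩ := h.exists_rep x
      have : Z x y = Z z y := by simp only [hZ, e1, e2]
      rw [this]
      exact hmin (show (z, y) ∈ Set.Icc (-Λ) Λ ×ˢ Set.Icc (t / 2) t from ⟨hz, hy⟩)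
    obtain ⟨-, hb1, hb2⟩ := hab
    dsimp only at hb1 hb2
    rcases hb1.eq_or_lt with hb1 | hb1
    · have e : Z a b = 0 := by
        simp only [hZ]
        rw [← hb1, min_eq_left (hlow a), show t - t / 2 = t / 2 by ring]
        field_simp; ring
      exact e.ge
    rcases hb2.eq_or_lt with hb2 | hb2
    · have e : Z a b = 0 := by
        simp only [hZ]
        rw [hb2, min_eq_right (hup a), h.sol.surface_val, sub_self, h.sol.bottom_val]
        field_simp; ring
      exact e.ge
    exfalso
    have hrefl : t - b < η a := by linarith [hlow a]
    have l2 := h.sol.laplace a (t - b) (by linarith) hrefl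
    have hIcc : Set.Icc (t / 2) t ∈ nhds b := Icc_mem_nhds hb1 hb2
    -- derivatives of the auxiliary terms
    have dR : ∀ y, HasDerivAt (fun y => ψ a (t - y)) (-py ψ a (t - y)) y := by
      intro y
      exact (hs.chain (hasDerivAt_const y a) ((hasDerivAt_id' y).const_sub t)).congr_deriv (by ring)
    have dR2 : HasDerivAt (fun y => -py ψ a (t - y)) (pyy ψ a (t - b)) b := by
      exact (hs.py.chain (hasDerivAt_const b a) ((hasDerivAt_id' b).const_sub t)).neg.congr_deriv
        (by simp only [pyy]; change _ = py (py ψ) a (t - b); ring)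
    have dQ : ∀ y, HasDerivAt (fun y => - (2 * y / t - 1) + κ * ((y - t / 2) * (t - y)))
        (- (2 / t) + κ * (3 * t / 2 - 2 * y)) y := by
      intro y
      have q1 := (((hasDerivAt_id' y).const_mul 2).div_const t).sub_const 1
      have q2 := (((hasDerivAt_id' y).sub_const (t / 2)).mul
        ((hasDerivAt_id' y).const_sub t)).const_mul κ
      exact (q1.neg.add q2).congr_deriv (by ring)
    have dQ2 : HasDerivAt (fun y => - (2 / t) + κ * (3 * t / 2 - 2 * y)) (-2 * κ) b := by
      exact ((((hasDerivAt_id' b).const_mul 2).const_sub (3 * t / 2)).const_mul κ).const_add _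
        |>.congr_deriv (by ring)
    rcases lt_trichotomy b (η a) with hlt | heq | hgt
    · have l1 := h.sol.laplace a b (by linarith) hlt
      have hxx : 0 ≤ pxx ψ a b - pxx ψ a (t - b) := by
        refine second_deriv_nonneg_of_isLocalMin
          (F := fun s => ψ s b - ψ s (t - b) - (2 * b / t - 1) + κ * ((b - t / 2) * (t - b)))
          (F' := fun s => px ψ s b - px ψ s (t - b)) (a := a)
          (fun s => (((hs.hx s b).sub (hs.hx s (t - b))).sub_const _).add_const _)
          ((hs.px.hx a b).sub (hs.px.hx a (t - b))) ?_
        filter_upwards [hηc.continuousAt.eventually (lt_mem_nhds hlt)] with s s1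
        have := hgl s b ⟨hb1.le, hb2.le⟩
        simpa only [hZ, min_eq_left hlt.le, min_eq_left s1.le] using this
      have hyy : 0 ≤ pyy ψ a b - pyy ψ a (t - b) + (-2 * κ) := by
        refine second_deriv_nonneg_of_isLocalMin
          (F := fun s => ψ a s - ψ a (t - s) + (- (2 * s / t - 1) + κ * ((s - t / 2) * (t - s))))
          (F' := fun s => py ψ a s - (-py ψ a (t - s)) + (- (2 / t) + κ * (3 * t / 2 - 2 * s)))
          (a := b) (fun s => ((hs.hy a s).sub (dR s)).add (dQ s))
          (((hs.py.hy a b).sub dR2).add dQ2) ?_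
        filter_upwards [gt_mem_nhds hlt, hIcc] with s s1 s2
        have := hgl a s s2
        simp only [hZ, min_eq_left hlt.le, min_eq_left s1.le] at this
        linarith
      linarith
    · have hA : py ψ a b - (-py ψ a (t - b)) + (- (2 / t) + κ * (3 * t / 2 - 2 * b)) ≤ 0 := by
        refine deriv_nonpos_of_left
          (F := fun s => ψ a s - ψ a (t - s) + (- (2 * s / t - 1) + κ * ((s - t / 2) * (t - s))))
          (((hs.hy a b).sub (dR b)).add (dQ b)) ?_
        filter_upwards [self_mem_nhdsWithin, nhdsWithin_le_nhds hIcc] with s s1 s2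
        have s1' : s < b := s1
        have := hgl a s s2
        simp only [hZ, min_eq_left heq.le, min_eq_left (s1'.le.trans heq.le)] at this
        linarith
      have hB : 0 ≤ - (-py ψ a (t - b)) + (- (2 / t) + κ * (3 * t / 2 - 2 * b)) := by
        refine deriv_nonneg_of_right
          (F := fun s => - ψ a (t - s) + (- (2 * s / t - 1) + κ * ((s - t / 2) * (t - s))))
          (((dR b).neg).add (dQ b)) ?_
        filter_upwards [self_mem_nhdsWithin, nhdsWithin_le_nhds hIcc] with s s1 s2
        have s1' : b < s := s1
        have := hgl a s s2
        simp only [hZ, min_eq_right heq.ge, min_eq_right (heq.ge.trans s1'.le)] at this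
        linarith
      have := hV a
      rw [← heq] at this
      linarith
    · have hxx : 0 ≤ - pxx ψ a (t - b) := by
        refine second_deriv_nonneg_of_isLocalMin
          (F := fun s => 1 - ψ s (t - b) - (2 * b / t - 1) + κ * ((b - t / 2) * (t - b)))
          (F' := fun s => - px ψ s (t - b)) (a := a)
          (fun s => (((hs.hx s (t - b)).const_sub 1).sub_const _).add_const _)
          ((hs.px.hx a (t - b)).neg) ?_
        filter_upwards [hηc.continuousAt.eventually (gt_mem_nhds hgt)] with s s1
        have := hgl s b ⟨hb1.le, hb2.le⟩
        simpa only [hZ, min_eq_right hgt.le, min_eq_right s1.le, h.sol.surface_val] using this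
      have hyy : 0 ≤ - pyy ψ a (t - b) + (-2 * κ) := by
        refine second_deriv_nonneg_of_isLocalMin
          (F := fun s => - ψ a (t - s) + (- (2 * s / t - 1) + κ * ((s - t / 2) * (t - s))))
          (F' := fun s => - (-py ψ a (t - s)) + (- (2 / t) + κ * (3 * t / 2 - 2 * s)))
          (a := b) (fun s => ((dR s).neg).add (dQ s))
          ((dR2.neg).add dQ2) ?_
        filter_upwards [lt_mem_nhds hgt, hIcc] with s s1 s2
        have := hgl a s s2
        simp only [hZ, min_eq_right hgt.le, min_eq_right s1.le] at this
        linarith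
      linarith
  -- let κ → 0
  have main0 : ∀ y ∈ Set.Icc (t / 2) t, 0 ≤ ψ 0 y - ψ 0 (t - y) - (2 * y / t - 1) := by
    intro y hy
    by_contra hneg
    push Not at hneg
    have hq : 0 ≤ (y - t / 2) * (t - y) := mul_nonneg (by linarith [hy.1]) (by linarith [hy.2])
    set N := ψ 0 y - ψ 0 (t - y) - (2 * y / t - 1)
    have h1 := main (-N / (2 * ((y - t / 2) * (t - y) + 1))) (by
      apply div_pos <;> linarith) y hy
    rw [← ht, min_eq_left hy.2] at h1
    have h2 : -N / (2 * ((y - t / 2) * (t - y) + 1)) * ((y - t / 2) * (t - y)) ≤ -N / 2 := by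
      rw [div_mul_eq_mul_div, div_le_div_iff₀ (by linarith) (by norm_num)]
      nlinarith
    change 0 ≤ N + _ at h1
    linarith
  have hfin : py ψ 0 t - (-py ψ 0 0) - 2 / t ≤ 0 := by
    have dR : HasDerivAt (fun y => ψ 0 (t - y)) (-py ψ 0 0) t :=
      (hs.chain (hasDerivAt_const t 0) ((hasDerivAt_id' t).const_sub t)).congr_deriv (by simp)
    have dl : HasDerivAt (fun y => 2 * y / t - 1) (2 / t) t :=
      ((((hasDerivAt_id' t).const_mul 2).div_const t).sub_const 1).congr_deriv (by ring)
    refine deriv_nonpos_of_left (((hs.hy 0 t).sub dR).sub dl) ?_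
    filter_upwards [Ioo_mem_nhdsLT (show t / 2 < t by linarith)] with s s1
    have e : ψ 0 t - ψ 0 (t - t) - (2 * t / t - 1) = 0 := by
      rw [sub_self, h.sol.bottom_val, ht, h.sol.surface_val, ← ht]
      field_simp; ring
    have := main0 s ⟨s1.1.le, s1.2.le⟩
    change ψ 0 t - ψ 0 (t - t) - (2 * t / t - 1) ≤ ψ 0 s - ψ 0 (t - s) - (2 * s / t - 1)
    linarith
  have h0 : 0 ≤ py ψ 0 0 := py_nonneg_closed hs h.sol.eta_pos hU le_rfl htpos.le
  have : py ψ 0 t ≤ 2 / t := by linarith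
  rwa [le_div_iff₀ htpos] at this

/-- Integrand of the flow force. -/
def ffG (γ r : ℝ) (ψ : ℝ → ℝ → ℝ) (x y : ℝ) : ℝ :=
  ((py ψ x y) ^ 2 - (px ψ x y) ^ 2) / 2 + r - y + γ * (ψ x y - 1)

theorem ffG_sm {γ r : ℝ} {ψ : ℝ → ℝ → ℝ} (hs : Sm ψ) : Sm (ffG γ r ψ) := by
  have h1 : ContDiff ℝ (⊤ : ℕ∞) (fun p : ℝ × ℝ => px ψ p.1 p.2) := hs.px
  have h2 : ContDiff ℝ (⊤ : ℕ∞) (fun p : ℝ × ℝ => py ψ p.1 p.2) := hs.py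
  have h3 : ContDiff ℝ (⊤ : ℕ∞) (fun p : ℝ × ℝ => ψ p.1 p.2) := hs
  unfold Sm ffG
  fun_prop

theorem ffG_px {γ r : ℝ} {ψ : ℝ → ℝ → ℝ} (hs : Sm ψ) (x y : ℝ) :
    px (ffG γ r ψ) x y = py ψ x y * px (py ψ) x y - px ψ x y * pxx ψ x y + γ * px ψ x y := by
  have h1 := hs.px.hx x y
  have h2 := hs.py.hx x y
  have h3 := hs.hx x y
  have := (((((h2.pow 2).sub (h1.pow 2)).div_const 2).add_const r).sub_const y).add
    ((h3.sub_const 1).const_mul γ)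
  have e := this.unique ((ffG_sm (γ := γ) (r := r) hs).hx x y)
  rw [← e]
  change _ = py ψ x y * px (py ψ) x y - px ψ x y * px (px ψ) x y + γ * px ψ x y
  norm_num
  ring

/-- Conservation of the flow force. -/
theorem flow_force_const {γ r : ℝ} {ψ : ℝ → ℝ → ℝ} {η : ℝ → ℝ} (h : StreamSolution γ ψ η r)
    (x x' : ℝ) : η x * ∫ s in (0 : ℝ)..1, ffG γ r ψ x (s * η x) =
      η x' * ∫ s in (0 : ℝ)..1, ffG γ r ψ x' (s * η x') := by
  have hs : Sm ψ := h.psi_smooth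
  have hG : Sm (ffG γ r ψ) := ffG_sm hs
  have hηc : Continuous η := h.eta_smooth.continuous
  have hηc' : Continuous (deriv η) := h.eta_smooth.continuous_deriv (by simp)
  have hηd : ∀ x, HasDerivAt η (deriv η x) x := fun x =>
    (h.eta_smooth.differentiable (by simp) x).hasDerivAt
  set F : ℝ → ℝ → ℝ := fun x s => η x * ffG γ r ψ x (s * η x) with hF
  set F' : ℝ → ℝ → ℝ := fun x s => deriv η x * ffG γ r ψ x (s * η x) +
    η x * (px (ffG γ r ψ) x (s * η x) + py (ffG γ r ψ) x (s * η x) * (s * deriv η x)) with hF'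
  have arg : Continuous (fun p : ℝ × ℝ => p.2 * η p.1) :=
    continuous_snd.mul (hηc.comp continuous_fst)
  have c0 := hG.cont2 (continuous_fst (X := ℝ) (Y := ℝ)) arg
  have c1 := hG.px.cont2 (continuous_fst (X := ℝ) (Y := ℝ)) arg
  have c2 := hG.py.cont2 (continuous_fst (X := ℝ) (Y := ℝ)) arg
  have c3 : Continuous (fun p : ℝ × ℝ => η p.1) := hηc.comp continuous_fst
  have c4 : Continuous (fun p : ℝ × ℝ => deriv η p.1) := hηc'.comp continuous_fst
  have hFc : Continuous (fun p : ℝ × ℝ => F p.1 p.2) := c3.mul c0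
  have hFc' : Continuous (fun p : ℝ × ℝ => F' p.1 p.2) :=
    (c4.mul c0).add (c3.mul (c1.add (c2.mul (continuous_snd.mul c4))))
  have hd : ∀ x s, HasDerivAt (fun x => F x s) (F' x s) x := by
    intro x s
    have := (hηd x).mul (hG.chain (hasDerivAt_id' x) ((hηd x).const_mul s))
    exact this.congr_deriv (by simp only [hF']; ring)
  have hz : ∀ x, ∫ s in (0 : ℝ)..1, F' x s = 0 := by
    intro x
    have hD : ∀ s ∈ Set.Ioo (0 : ℝ) 1, HasDerivAt (fun s => px ψ x (s * η x) * py ψ x (s * η x) +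
        s * deriv η x * ffG γ r ψ x (s * η x)) (F' x s) s := by
      intro s hs'
      have ha : HasDerivAt (fun s => s * η x) (η x) s := by
        simpa using (hasDerivAt_id' s).mul_const (η x)
      have hc := hasDerivAt_const s x
      have hb : HasDerivAt (fun s => s * deriv η x) (deriv η x) s := by
        simpa using (hasDerivAt_id' s).mul_const (deriv η x)
      have := ((hs.px.chain hc ha).mul (hs.py.chain hc ha)).add (hb.mul (hG.chain hc ha))
      refine this.congr_deriv ?_
      have hp := h.eta_pos x
      have hl := h.laplace x (s * η x) (mul_pos hs'.1 hp) (by nlinarith [hs'.2])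
      simp only [hF', ffG_px hs, hs.comm]
      have e1 : py (py ψ) x (s * η x) = γ - pxx ψ x (s * η x) := by
        rw [← hl]; simp only [pyy]; change _ = _ + py (py ψ) x (s * η x) - _; ring
      rw [e1]
      ring
    have hcont : Continuous (fun s : ℝ => px ψ x (s * η x) * py ψ x (s * η x) +
        s * deriv η x * ffG γ r ψ x (s * η x)) := by
      have d0 : Continuous (fun s : ℝ => s * η x) := by fun_prop
      exact ((hs.px.cont2 continuous_const d0).mul (hs.py.cont2 continuous_const d0)).add
        ((by fun_prop : Continuous fun s : ℝ => s * deriv η x).mul (hG.cont2 continuous_const d0))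
    have hFx' : Continuous (F' x) := hFc'.comp (by fun_prop : Continuous fun s : ℝ => (x, s))
    rw [intervalIntegral.integral_eq_sub_of_hasDerivAt_of_le zero_le_one hcont.continuousOn hD
      (hFx'.intervalIntegrable _ _)]
    simp only [one_mul, zero_mul]
    rw [bottom_px h]
    have hb := h.bernoulli x
    unfold ffG
    rw [h.surface_val]
    rw [surf_px h] at hb ⊢
    rw [← hb]
    ring
  have hall : ∀ x, HasDerivAt (fun x => ∫ s in (0 : ℝ)..1, F x s) 0 x := by
    intro x
    have := leibniz hFc hFc' hd x
    rwa [hz x] at this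
  have := is_const_of_deriv_eq_zero (fun x => (hall x).differentiableAt)
    (fun x => (hall x).deriv) x x'
  simpa only [hF, intervalIntegral.integral_const_mul] using this

/-- The flow force in a column with vanishing `ψ_x`. -/
theorem column {γ r : ℝ} {ψ : ℝ → ℝ → ℝ} {η : ℝ → ℝ} (h : StreamSolution γ ψ η r) {x : ℝ}
    (hx : ∀ y, px ψ x y = 0) :
    η x * ∫ s in (0 : ℝ)..1, ffG γ r ψ x (s * η x) =
      (∫ y in (0 : ℝ)..(η x), (py ψ x y - γ * y) ^ 2) / 2 + γ * η x - γ ^ 2 * (η x) ^ 3 / 6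
        + (r - γ) * η x - (η x) ^ 2 / 2 := by
  have hs : Sm ψ := h.psi_smooth
  have e0 := intervalIntegral.mul_integral_comp_mul_right (a := 0) (b := 1) (f := ffG γ r ψ x) (η x)
  rw [e0, zero_mul, one_mul]
  have cy : Continuous (fun y => py ψ x y) := hs.py.cont2 continuous_const continuous_id
  have c1 : Continuous (fun y => (py ψ x y - γ * y) ^ 2) := by fun_prop
  have cG : Continuous (ffG γ r ψ x) := (ffG_sm hs).cont2 continuous_const continuous_id
  have hD : ∀ y, HasDerivAt (fun y => γ * (y * ψ x y) - γ ^ 2 * y ^ 3 / 6 + (r - γ) * y - y ^ 2 / 2)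
      (ffG γ r ψ x y - (py ψ x y - γ * y) ^ 2 / 2) y := by
    intro y
    have a1 := ((hasDerivAt_id' y).mul (hs.hy x y)).const_mul γ
    have a2 := ((hasDerivAt_pow 3 y).const_mul (γ ^ 2)).div_const 6
    have a3 := (hasDerivAt_id' y).const_mul (r - γ)
    have a4 := (hasDerivAt_pow 2 y).div_const 2
    refine (((a1.sub a2).add a3).sub a4).congr_deriv ?_
    unfold ffG
    rw [hx]
    norm_num
    ring
  have e1 := intervalIntegral.integral_eq_sub_of_hasDerivAt (a := 0) (b := η x)
    (fun y _ => hD y) ((cG.sub (c1.div_const 2)).intervalIntegrable _ _)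
  rw [intervalIntegral.integral_sub (cG.intervalIntegrable _ _)
    ((c1.div_const 2).intervalIntegrable _ _), intervalIntegral.integral_div, h.surface_val] at e1
  simp only [zero_mul, mul_zero] at e1
  linarith

/-- Consequence of the flow force balance between crest and trough. -/
theorem StokesWave.force_ineq {γ r Λ : ℝ} {ψ : ℝ → ℝ → ℝ} {η : ℝ → ℝ}
    (h : StokesWave γ ψ η r Λ) (hU : Unidirectional ψ η) :
    1 - γ * (η Λ) ^ 2 / 2 ≤ η Λ * (py ψ Λ (η Λ) - γ * η Λ) ∧
    γ * η 0 - γ ^ 2 * (η 0) ^ 3 / 6 +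
      (η 0 - η Λ) * (((py ψ 0 (η 0)) ^ 2 + (py ψ Λ (η Λ)) ^ 2) / 4 - γ) ≤
    (py ψ Λ (η Λ) - γ * η Λ) * (1 - γ * (η Λ) ^ 2 / 2) / 2 + γ * η Λ - γ ^ 2 * (η Λ) ^ 3 / 6 := by
  have hs : Sm ψ := h.sol.psi_smooth
  have hc := column h.sol h.px_zero
  have ht := column h.sol h.px_lam
  have hff := flow_force_const h.sol 0 Λ
  rw [hc, ht] at hff
  have b0 := h.sol.bernoulli 0
  have b1 := h.sol.bernoulli Λ
  rw [h.px_zero] at b0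
  rw [h.px_lam] at b1
  have hpos := h.sol.eta_pos Λ
  have hpos0 := h.sol.eta_pos 0
  have cy : Continuous (fun y => py ψ Λ y - γ * y) := by
    have : Continuous (fun y => py ψ Λ y) := hs.py.cont2 continuous_const continuous_id
    fun_prop
  have hcr : 0 ≤ ∫ y in (0 : ℝ)..(η 0), (py ψ 0 y - γ * y) ^ 2 :=
    intervalIntegral.integral_nonneg hpos0.le (fun y _ => sq_nonneg _)
  have hmono : MonotoneOn (fun y => py ψ Λ y - γ * y) (Set.Icc 0 (η Λ)) := by
    have hd : ∀ y, HasDerivAt (fun y => py ψ Λ y - γ * y) (pyy ψ Λ y - γ) y := by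
      intro y
      exact ((hs.py.hy Λ y).sub ((hasDerivAt_id' y).const_mul γ)).congr_deriv
        (by simp only [mul_one]; rfl)
    refine monotoneOn_of_deriv_nonneg (convex_Icc _ _) cy.continuousOn
      (fun y _ => (hd y).differentiableAt.differentiableWithinAt) ?_
    intro y hy
    rw [interior_Icc] at hy
    rw [(hd y).deriv]
    linarith [h.trough_pyy hU hy.1 hy.2]
  set V := py ψ Λ (η Λ) with hV
  set H := η Λ with hH
  have hw0 : ∀ y ∈ Set.Icc 0 H, 0 ≤ py ψ Λ y - γ * y := by
    intro y hy
    have h1 := hmono ⟨le_rfl, hpos.le⟩ hy hy.1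
    have h2 := py_nonneg_closed hs h.sol.eta_pos hU (x := Λ) le_rfl hpos.le
    simp only [mul_zero, sub_zero] at h1
    linarith
  have hw1 : ∀ y ∈ Set.Icc 0 H, py ψ Λ y - γ * y ≤ V - γ * H := by
    intro y hy
    exact hmono hy ⟨hpos.le, le_rfl⟩ hy.2
  have hintegral : ∫ y in (0 : ℝ)..H, (py ψ Λ y - γ * y) = 1 - γ * H ^ 2 / 2 := by
    have hD : ∀ y, HasDerivAt (fun y => ψ Λ y - γ * y ^ 2 / 2) (py ψ Λ y - γ * y) y := by
      intro y
      exact ((hs.hy Λ y).sub (((hasDerivAt_pow 2 y).const_mul γ).div_const 2)).congr_deriv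
        (by norm_num; ring)
    rw [intervalIntegral.integral_eq_sub_of_hasDerivAt (fun y _ => hD y)
      (cy.intervalIntegrable _ _), hH, h.sol.surface_val, h.sol.bottom_val]
    ring
  have i1 : ∫ y in (0 : ℝ)..H, (py ψ Λ y - γ * y) ≤ ∫ y in (0 : ℝ)..H, (V - γ * H) :=
    intervalIntegral.integral_mono_on hpos.le (cy.intervalIntegrable _ _)
      intervalIntegrable_const hw1
  have i2 : ∫ y in (0 : ℝ)..H, (py ψ Λ y - γ * y) ^ 2 ≤
      ∫ y in (0 : ℝ)..H, (V - γ * H) * (py ψ Λ y - γ * y) :=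
    intervalIntegral.integral_mono_on hpos.le ((cy.pow 2).intervalIntegrable _ _)
      ((cy.const_mul _).intervalIntegrable _ _) (fun y hy => by
        nlinarith [hw0 y hy, hw1 y hy])
  rw [intervalIntegral.integral_const_mul] at i2
  rw [intervalIntegral.integral_const, smul_eq_mul] at i1
  rw [hintegral] at i1 i2
  refine ⟨by linarith, ?_⟩
  have er : (η 0 - H) = (V ^ 2 - (py ψ 0 (η 0)) ^ 2) / 2 := by nlinarith
  have er2 : (η 0 - H) * ((py ψ 0 (η 0)) ^ 2 + V ^ 2) / 4
      = (η 0 - H) * (r - η 0) + (η 0 - H) ^ 2 / 2 := by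
    have : (py ψ 0 (η 0)) ^ 2 + V ^ 2 = 4 * (r - η 0) + 2 * (η 0 - H) := by nlinarith
    rw [this]; ring
  nlinarith

/-- The scaled numerical inequality. -/
theorem scaled_ineq {T H U W : ℝ} (hT1 : 99 / 100 ≤ T) (hT2 : T ≤ 101 / 100) (hH : 0 < H)
    (hHT : H < T / 2) (hU : 198 / 100 ≤ U) (hW : 1 - H ^ 2 ≤ H * (W - 2 * H)) :
    (W - 2 * H) * (1 - H ^ 2) / 2 + 2 * H - 2 / 3 * H ^ 3 <
      2 * T - 2 / 3 * T ^ 3 + (T - H) * ((U ^ 2 + W ^ 2) / 4 - 2) := by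
  have hH2 : H < 101 / 200 := by linarith
  obtain ⟨W0, hW0⟩ : ∃ W0 : ℝ, W0 * H = H ^ 2 + 1 := ⟨(H ^ 2 + 1) / H, by field_simp⟩
  have hWW : W0 ≤ W := by
    by_contra hc
    push Not at hc
    nlinarith
  have hW0b : 2 ≤ W0 := by
    by_contra hc
    push Not at hc
    nlinarith
  have s1 : 1 - H ^ 2 ≤ (T - H) * W0 := by
    have : H * (1 - H ^ 2) ≤ H * ((T - H) * W0) := by
      have : H * ((T - H) * W0) = (T - H) * (H ^ 2 + 1) := by rw [← hW0]; ring
      rw [this]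
      nlinarith
    exact le_of_mul_le_mul_left this hH
  have s2 : (T - H) * W0 ^ 2 / 4 - W0 * (1 - H ^ 2) / 2 ≤
      (T - H) * W ^ 2 / 4 - W * (1 - H ^ 2) / 2 := by
    have hTH : 0 < T - H := by linarith
    nlinarith [mul_nonneg (sub_nonneg.2 hWW) (sub_nonneg.2 s1),
      mul_nonneg hTH.le (mul_nonneg (sub_nonneg.2 hWW) (sub_nonneg.2 hWW))]
  have s3 : 1333 / 1000 - 1/10000 ≤ 2 * T - 2 / 3 * T ^ 3 := by
    nlinarith [mul_nonneg (sub_nonneg.2 hT1) (sub_nonneg.2 hT2)]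
  have s4 : (T - H) * (98 / 100) ≤ (T - H) * (U ^ 2 / 4) := by
    apply mul_le_mul_of_nonneg_left _ (by linarith)
    nlinarith
  have hW0c : 2448 / 1000 ≤ W0 := by
    by_contra hc
    push Not at hc
    nlinarith
  have s5 : (99 / 100 - H) * (W0 ^ 2 / 4 - 102 / 100) ≤ (T - H) * (W0 ^ 2 / 4 - 102 / 100) := by
    apply mul_le_mul_of_nonneg_right (by linarith)
    nlinarith
  have s6 : (W0 - 2 * H) * (1 - H ^ 2) / 2 + 2 * H - 2 / 3 * H ^ 3 <
      13329 / 10000 + (99 / 100 - H) * (W0 ^ 2 / 4 - 102 / 100) := by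
    have e : W0 = (H ^ 2 + 1) / H := by rw [eq_div_iff hH.ne']; exact hW0
    have : 0 < (13329 / 10000 + (99 / 100 - H) * (W0 ^ 2 / 4 - 102 / 100)
      - ((W0 - 2 * H) * (1 - H ^ 2) / 2 + 2 * H - 2 / 3 * H ^ 3)) * H ^ 2 := by
      have e2 : (13329 / 10000 + (99 / 100 - H) * (W0 ^ 2 / 4 - 102 / 100)
      - ((W0 - 2 * H) * (1 - H ^ 2) / 2 + 2 * H - 2 / 3 * H ^ 3)) * H ^ 2 =
        13329 / 10000 * H ^ 2 + (99 / 100 - H) * ((H ^ 2 + 1) ^ 2 / 4 - 102 / 100 * H ^ 2)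
        - ((H * (H ^ 2 + 1) - 2 * H ^ 3) * (1 - H ^ 2) / 2 + 2 * H ^ 3 - 2 / 3 * H ^ 5) := by
        rw [← hW0]; ring
      rw [e2]
      have hk : 0 < 101 / 200 - H := by linarith
      nlinarith [pow_pos hH 2, pow_pos hH 3, pow_pos hH 4, pow_pos hH 5,
        mul_pos hH hk, mul_pos (pow_pos hH 2) hk, mul_pos (pow_pos hH 3) hk,
        mul_pos (pow_pos hH 4) hk, sq_nonneg (H - 1 / 2), sq_nonneg (H - 1 / 4)]
    have := (pos_iff_pos_of_mul_pos this).2 (by positivity)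
    linarith
  nlinarith

theorem final_contra {γ L t H u V ε : ℝ} (hL : 0 < L) (hγL : γ * L ^ 2 = 2)
    (h1 : 99 / 100 * L ≤ t) (h2 : t ≤ 101 / 100 * L) (hH : 0 < H) (hHt : H < t / 2)
    (hu : 198 / 100 ≤ u * L)
    (f1 : 1 - γ * H ^ 2 / 2 ≤ H * (V - γ * H))
    (f2 : γ * t - γ ^ 2 * t ^ 3 / 6 + (t - H) * ((u ^ 2 + V ^ 2) / 4 - γ) ≤
      (V - γ * H) * (1 - γ * H ^ 2 / 2) / 2 + γ * H - γ ^ 2 * H ^ 3 / 6) : False := by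
  have hLn := hL.ne'
  have hg : γ = 2 / L ^ 2 := by field_simp; exact hγL
  obtain ⟨T, rfl⟩ : ∃ T, t = T * L := ⟨t / L, by field_simp⟩
  obtain ⟨K, rfl⟩ : ∃ K, H = K * L := ⟨H / L, by field_simp⟩
  obtain ⟨U, rfl⟩ : ∃ U, u = U / L := ⟨u * L, by field_simp⟩
  obtain ⟨W, rfl⟩ : ∃ W, V = W / L := ⟨V * L, by field_simp⟩
  subst hg
  have g1 : 1 - K ^ 2 ≤ K * (W - 2 * K) := by
    have e1 : 1 - 2 / L ^ 2 * (K * L) ^ 2 / 2 = 1 - K ^ 2 := by field_simp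
    have e2 : K * L * (W / L - 2 / L ^ 2 * (K * L)) = K * (W - 2 * K) := by field_simp
    rwa [e1, e2] at f1
  have e3 : (2 / L ^ 2 * (T * L) - (2 / L ^ 2) ^ 2 * (T * L) ^ 3 / 6 +
      (T * L - K * L) * (((U / L) ^ 2 + (W / L) ^ 2) / 4 - 2 / L ^ 2)) =
      (2 * T - 2 / 3 * T ^ 3 + (T - K) * ((U ^ 2 + W ^ 2) / 4 - 2)) / L := by
    field_simp; ring
  have e4 : (W / L - 2 / L ^ 2 * (K * L)) * (1 - 2 / L ^ 2 * (K * L) ^ 2 / 2) / 2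
      + 2 / L ^ 2 * (K * L) - (2 / L ^ 2) ^ 2 * (K * L) ^ 3 / 6 =
      ((W - 2 * K) * (1 - K ^ 2) / 2 + 2 * K - 2 / 3 * K ^ 3) / L := by
    field_simp; ring
  rw [e3, e4, div_le_div_iff_of_pos_right hL] at f2
  have := scaled_ineq (T := T) (H := K) (U := U) (W := W) (le_of_mul_le_mul_right h1 hL)
    (le_of_mul_le_mul_right h2 hL) (pos_of_mul_pos_left hH hL.le)
    (by
      have : K * L < (T / 2) * L := by linarith
      exact lt_of_mul_lt_mul_right this hL.le)
    (by
      have : U / L * L = U := by field_simp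
      linarith) g1
  linarith

/-- Lemma 4.4: there is an absolute `ε⋆ > 0` such that if `|ε|, |1 - B₀| < ε⋆`,
`ψ_y ≥ √(2γ)(1 - ε) > 0` at the crest and `η̂ ≤ B₀ √(2/γ)`, then
`η̂ ≤ √(2/γ) / (1 - ε)`. -/
theorem crest_bound_from_crest_velocity :
    ∃ εstar > (0 : ℝ), ∀ γ > (0 : ℝ), ∀ ε B₀ : ℝ,
      |ε| < εstar → |1 - B₀| < εstar →
      ∀ (ψ : ℝ → ℝ → ℝ) (η : ℝ → ℝ) (r Λ : ℝ),
        StokesWave γ ψ η r Λ → Unidirectional ψ η →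
        py ψ 0 (η 0) ≥ Real.sqrt (2 * γ) * (1 - ε) →
        Real.sqrt (2 * γ) * (1 - ε) > 0 →
        η 0 ≤ B₀ * Real.sqrt (2 / γ) →
        η 0 ≤ Real.sqrt (2 / γ) * (1 / (1 - ε)) := by
  refine ⟨1 / 100, by norm_num, ?_⟩
  intro γ hγ ε B₀ hε hB ψ η r Λ h hU hu hpos hη
  have hε' := abs_lt.1 hε
  have hB' := abs_lt.1 hB
  have h1ε : 0 < 1 - ε := by linarith
  set L := Real.sqrt (2 / γ) with hLdef
  set S := Real.sqrt (2 * γ) with hSdef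
  have hL : 0 < L := Real.sqrt_pos.2 (by positivity)
  have hγL : γ * L ^ 2 = 2 := by
    rw [hLdef, Real.sq_sqrt (by positivity)]; field_simp
  have hSL : S * L = 2 := by
    rw [hSdef, hLdef, ← Real.sqrt_mul (by positivity)]
    have : 2 * γ * (2 / γ) = 2 ^ 2 := by field_simp
    rw [this, Real.sqrt_sq (by norm_num)]
  have ht := h.sol.eta_pos 0
  rw [mul_one_div, le_div_iff₀ h1ε]
  by_cases hhalf : η 0 / 2 ≤ η Λ
  · have h2 := h.reflection hγ hU (by linarith) hhalf
    have h3 : S * (1 - ε) * η 0 ≤ S * L := by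
      rw [hSL]
      exact le_trans (mul_le_mul_of_nonneg_right hu ht.le) h2
    have hS : 0 < S := Real.sqrt_pos.2 (by positivity)
    have h4 : S * (η 0 * (1 - ε)) ≤ S * L := by linarith
    exact le_of_mul_le_mul_left h4 hS
  · push Not at hhalf
    by_contra hc
    push Not at hc
    obtain ⟨f1, f2⟩ := h.force_ineq hU
    refine final_contra (ε := ε) hL hγL ?_ ?_ (h.sol.eta_pos Λ) hhalf ?_ f1 f2
    · nlinarith
    · nlinarith
    · have : S * (1 - ε) * L ≤ py ψ 0 (η 0) * L := mul_le_mul_of_nonneg_right hu hL.le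
      nlinarith
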